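/- Fix a convex set K ⊆ ℝ and a continuous map I : B₀(Σ,K) → ℝ. The following are equivalent: (i) I is monotone, normalized, and constant superadditive; (ii) for every φ ∈ B₀(Σ,K) there exists a family Φ_φ of monotone, constant additive, and convex real-valued functionals on B₀(Σ,K) such that I(φ) = min_{J∈Φ_φ} J(φ) (minimum attained), min_{J∈Φ_φ} J(k·1_S) = k for all k ∈ K, and Φ_{φ₁} ⊆ Φ_{φ₂} whenever φ₁ ≥ φ₂ pointwise; (iii) for every φ ∈ B₀(Σ,K) there exists a family Ψ_φ of monotone, constant additive, and concave real-valued functionals on B₀(Σ,K) such that I(φ) = max_{H∈Ψ_φ} H(φ) (maximum attained), max_{H∈Ψ_φ} H(k·1_S) = k for all k ∈ K, and Ψ_{φ₁} ⊆ Ψ_{φ₂} whenever φ₂ ≥ φ₁ pointwise. -/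

import Mathlib

variable {S : Type*} [MeasurableSpace S]

/-- `B₀(Σ,K)`: the set of Σ-measurable simple (finite-range) functions `φ : S → ℝ`
with values in `K`. -/
def B0 (K : Set ℝ) : Set (S → ℝ) :=
  {φ | Measurable φ ∧ (Set.range φ).Finite ∧ Set.range φ ⊆ K}

/-- `I` is monotone on `B₀(Σ,K)`. -/
def MonotoneOnB0 (K : Set ℝ) (I : (S → ℝ) → ℝ) : Prop :=
  ∀ φ : S → ℝ, φ ∈ B0 K → ∀ ψ : S → ℝ, ψ ∈ B0 K → (∀ s, ψ s ≤ φ s) → I ψ ≤ I φ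

/-- `I` is normalized on `B₀(Σ,K)`. -/
def NormalizedOnB0 (K : Set ℝ) (I : (S → ℝ) → ℝ) : Prop :=
  ∀ k ∈ K, I (fun _ => k) = k

/-- `I` is continuous on `B₀(Σ,K)` with respect to the supremum norm. -/
def SupNormContinuous (K : Set ℝ) (I : (S → ℝ) → ℝ) : Prop :=
  ∀ φ : S → ℝ, φ ∈ B0 K → ∀ ε : ℝ, 0 < ε → ∃ δ > (0 : ℝ), ∀ ψ : S → ℝ, ψ ∈ B0 K →
    (∀ s, |ψ s - φ s| ≤ δ) → |I ψ - I φ| ≤ ε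

/-- `I` is constant superadditive on `B₀(Σ,K)`. -/
def ConstSuperadd (K : Set ℝ) (I : (S → ℝ) → ℝ) : Prop :=
  ∀ φ : S → ℝ, φ ∈ B0 K → ∀ k : ℝ, 0 ≤ k → (fun s => φ s + k) ∈ B0 K →
    I φ + k ≤ I (fun s => φ s + k)

/-- `I` is constant additive on `B₀(Σ,K)`: `I(φ + k) = I(φ) + k` for every `k ∈ ℝ` with
`φ + k ∈ B₀(Σ,K)`. -/
def ConstAdditive (K : Set ℝ) (I : (S → ℝ) → ℝ) : Prop :=
  ∀ φ : S → ℝ, φ ∈ B0 K → ∀ k : ℝ, (fun s => φ s + k) ∈ B0 K →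
    I (fun s => φ s + k) = I φ + k

/-- `I` is convex on `B₀(Σ,K)`. -/
def ConvexOnB0 (K : Set ℝ) (I : (S → ℝ) → ℝ) : Prop :=
  ∀ α : ℝ, α ∈ Set.Icc (0 : ℝ) 1 → ∀ φ : S → ℝ, φ ∈ B0 K → ∀ ψ : S → ℝ, ψ ∈ B0 K →
    I (fun s => α * φ s + (1 - α) * ψ s) ≤ α * I φ + (1 - α) * I ψ

/-- `I` is concave on `B₀(Σ,K)`. -/
def ConcaveOnB0 (K : Set ℝ) (I : (S → ℝ) → ℝ) : Prop :=
  ∀ α : ℝ, α ∈ Set.Icc (0 : ℝ) 1 → ∀ φ : S → ℝ, φ ∈ B0 K → ∀ ψ : S → ℝ, ψ ∈ B0 K →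
    α * I φ + (1 - α) * I ψ ≤ I (fun s => α * φ s + (1 - α) * ψ s)

/-- The largest excess `sup (φ - ψ)` of `φ` over `ψ`. -/
noncomputable def supDiff (φ ψ : S → ℝ) : ℝ := ⨆ s, (φ s - ψ s)

theorem supDiff_le {T : Type*} [Nonempty T] {φ ψ : T → ℝ} {c : ℝ} (h : ∀ s, φ s ≤ ψ s + c) :
    supDiff φ ψ ≤ c :=
  ciSup_le fun s => by linarith [h s]

theorem supDiff_self {T : Type*} [Nonempty T] (φ : T → ℝ) : supDiff φ φ = 0 := by
  simp [supDiff]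

theorem supDiff_const {T : Type*} [Nonempty T] (k c : ℝ) :
    supDiff (fun _ : T => k) (fun _ => c) = k - c := by
  simp [supDiff]

theorem const_mem_B0 {K : Set ℝ} {k : ℝ} (hk : k ∈ K) : (fun _ : S => k) ∈ B0 K :=
  ⟨measurable_const, Set.finite_range_const,
    Set.range_subset_iff.2 fun _ => hk⟩

theorem le_add_supDiff {K L : Set ℝ} {φ ψ : S → ℝ} (hφ : φ ∈ B0 K) (hψ : ψ ∈ B0 L) (s : S) :
    φ s ≤ ψ s + supDiff φ ψ := by
  obtain ⟨a, ha⟩ := hφ.2.1.bddAbove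
  obtain ⟨b, hb⟩ := hψ.2.1.bddBelow
  have hbdd : BddAbove (Set.range fun s => φ s - ψ s) := by
    refine ⟨a - b, ?_⟩
    rintro _ ⟨t, rfl⟩
    have := ha ⟨t, rfl⟩
    have := hb ⟨t, rfl⟩
    dsimp only
    linarith
  have h : φ s - ψ s ≤ supDiff φ ψ := le_ciSup hbdd s
  linarith

theorem exists_forall_le_of_mem_B0 [Nonempty S] {K : Set ℝ} {φ : S → ℝ} (hφ : φ ∈ B0 K) :
    ∃ t, ∀ s, φ s ≤ φ t := by
  obtain ⟨_, ⟨t, rfl⟩, ht⟩ :=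
    Set.exists_max_image (Set.range φ) id hφ.2.1 (Set.range_nonempty φ)
  exact ⟨t, fun s => ht _ ⟨s, rfl⟩⟩

theorem exists_forall_ge_of_mem_B0 [Nonempty S] {K : Set ℝ} {φ : S → ℝ} (hφ : φ ∈ B0 K) :
    ∃ t, ∀ s, φ t ≤ φ s := by
  obtain ⟨_, ⟨t, rfl⟩, ht⟩ :=
    Set.exists_min_image (Set.range φ) id hφ.2.1 (Set.range_nonempty φ)
  exact ⟨t, fun s => ht _ ⟨s, rfl⟩⟩

theorem mem_of_mem_B0 {K : Set ℝ} {φ : S → ℝ} (hφ : φ ∈ B0 K) (s : S) : φ s ∈ K :=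
  hφ.2.2 ⟨s, rfl⟩

/-- A monotone and constant superadditive functional grows from `φ` to `ψ ≥ φ` by at least
the gap `inf (ψ - φ)`. -/
theorem le_add_supDiff_of_constSuperadd [Nonempty S] {K : Set ℝ} (hK : Convex ℝ K)
    {I : (S → ℝ) → ℝ} (hmono : MonotoneOnB0 K I) (hsup : ConstSuperadd K I)
    {φ ψ : S → ℝ} (hφ : φ ∈ B0 K) (hψ : ψ ∈ B0 K) (hle : ∀ s, φ s ≤ ψ s) :
    I φ ≤ I ψ + supDiff φ ψ := by
  have hD : supDiff φ ψ ≤ 0 := supDiff_le fun s => by simpa using hle s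
  have hshift : ∀ s, φ s + -supDiff φ ψ ≤ ψ s := fun s => by
    linarith [le_add_supDiff hφ hψ s]
  have hmem : (fun s => φ s + -supDiff φ ψ) ∈ B0 K := by
    refine ⟨hφ.1.add_const _, ?_, ?_⟩
    · refine (hφ.2.1.image (fun x => x + -supDiff φ ψ)).subset ?_
      rintro _ ⟨s, rfl⟩
      exact ⟨_, ⟨s, rfl⟩, rfl⟩
    · rintro _ ⟨s, rfl⟩
      exact hK.ordConnected.out (mem_of_mem_B0 hφ s) (mem_of_mem_B0 hψ s)
        ⟨by linarith, hshift s⟩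
  have h₁ := hsup φ hφ _ (neg_nonneg.2 hD) hmem
  have h₂ := hmono ψ hψ _ hmem hshift
  linarith

theorem monotone_constAdditive_convex_supDiff [Nonempty S] {K : Set ℝ}
    {ψ : S → ℝ} (hψ : ψ ∈ B0 K) (c : ℝ) :
    MonotoneOnB0 K (fun φ => c + supDiff φ ψ) ∧ ConstAdditive K (fun φ => c + supDiff φ ψ) ∧
      ConvexOnB0 K (fun φ => c + supDiff φ ψ) := by
  refine ⟨fun φ hφ χ _ h => ?_, fun φ hφ k hk => ?_, fun α hα φ hφ χ hχ => ?_⟩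
  · have : supDiff χ ψ ≤ supDiff φ ψ :=
      supDiff_le fun s => (h s).trans (le_add_supDiff hφ hψ s)
    simpa using this
  · have h₁ : supDiff (fun s => φ s + k) ψ ≤ supDiff φ ψ + k :=
      supDiff_le fun s => by linarith [le_add_supDiff hφ hψ s]
    have h₂ : supDiff φ ψ ≤ supDiff (fun s => φ s + k) ψ - k :=
      supDiff_le fun s => by linarith [le_add_supDiff hk hψ s]
    dsimp only
    linarith
  · have : supDiff (fun s => α * φ s + (1 - α) * χ s) ψ ≤
        α * supDiff φ ψ + (1 - α) * supDiff χ ψ := supDiff_le fun s => by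
      have h₁ := mul_le_mul_of_nonneg_left (le_add_supDiff hφ hψ s) hα.1
      have h₂ := mul_le_mul_of_nonneg_left (le_add_supDiff hχ hψ s) (sub_nonneg.2 hα.2)
      linarith
    dsimp only
    linarith

theorem monotone_constAdditive_concave_supDiff [Nonempty S] {K : Set ℝ}
    {ψ : S → ℝ} (hψ : ψ ∈ B0 K) (c : ℝ) :
    MonotoneOnB0 K (fun φ => c - supDiff ψ φ) ∧ ConstAdditive K (fun φ => c - supDiff ψ φ) ∧
      ConcaveOnB0 K (fun φ => c - supDiff ψ φ) := by
  refine ⟨fun φ _ χ hχ h => ?_, fun φ hφ k hk => ?_, fun α hα φ hφ χ hχ => ?_⟩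
  · have : supDiff ψ φ ≤ supDiff ψ χ :=
      supDiff_le fun s => by linarith [h s, le_add_supDiff hψ hχ s]
    dsimp only
    linarith
  · have h₁ : supDiff ψ (fun s => φ s + k) ≤ supDiff ψ φ - k :=
      supDiff_le fun s => by linarith [le_add_supDiff hψ hφ s]
    have h₂ : supDiff ψ φ ≤ supDiff ψ (fun s => φ s + k) + k :=
      supDiff_le fun s => by linarith [le_add_supDiff hψ hk s]
    dsimp only
    linarith
  · have : supDiff ψ (fun s => α * φ s + (1 - α) * χ s) ≤
        α * supDiff ψ φ + (1 - α) * supDiff ψ χ := supDiff_le fun s => by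
      have h₁ := mul_le_mul_of_nonneg_left (le_add_supDiff hψ hφ s) hα.1
      have h₂ := mul_le_mul_of_nonneg_left (le_add_supDiff hψ hχ s) (sub_nonneg.2 hα.2)
      linarith
    dsimp only
    linarith

theorem nonempty_of_constSuperadd {K : Set ℝ} {I : (S → ℝ) → ℝ} (h : ConstSuperadd K I) :
    Nonempty S := by
  by_contra hS
  rw [not_nonempty_iff] at hS
  have hmem : ∀ φ : S → ℝ, φ ∈ B0 K := fun φ =>
    ⟨measurable_of_empty φ, Set.finite_range φ, Set.range_subset_iff.2 fun s => hS.elim s⟩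
  have h₁ := h (fun _ => 0) (hmem _) 1 zero_le_one (hmem _)
  rw [Subsingleton.elim (fun s : S => (0 : ℝ) + 1) (fun _ => 0)] at h₁
  linarith

/-- for a convex `K ⊆ ℝ` and a continuous `I : B₀(Σ,K) → ℝ`, the following
are equivalent: (i) `I` is monotone, normalized, and constant superadditive; (ii) act-dependent
minimum representation via monotone, constant additive, convex functionals, with families
enlarging as the act decreases; (iii) act-dependent maximum representation via monotone,
constant additive, concave functionals, with families enlarging as the act increases. -/
theorem stmt_16 (K : Set ℝ) (hK : Convex ℝ K) (I : (S → ℝ) → ℝ)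
    (hcont : SupNormContinuous K I) :
    ((MonotoneOnB0 K I ∧ NormalizedOnB0 K I ∧ ConstSuperadd K I) ↔
      (∃ Φ : (S → ℝ) → Set ((S → ℝ) → ℝ),
        (∀ φ : S → ℝ, φ ∈ B0 K → ∀ J ∈ Φ φ,
          MonotoneOnB0 K J ∧ ConstAdditive K J ∧ ConvexOnB0 K J) ∧
        (∀ φ : S → ℝ, φ ∈ B0 K → (∀ J ∈ Φ φ, I φ ≤ J φ) ∧ ∃ J ∈ Φ φ, J φ = I φ) ∧
        (∀ φ : S → ℝ, φ ∈ B0 K → ∀ k ∈ K,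
          (∀ J ∈ Φ φ, k ≤ J (fun _ => k)) ∧ ∃ J ∈ Φ φ, J (fun _ => k) = k) ∧
        (∀ φ₁ : S → ℝ, φ₁ ∈ B0 K → ∀ φ₂ : S → ℝ, φ₂ ∈ B0 K →
          (∀ s, φ₂ s ≤ φ₁ s) → Φ φ₁ ⊆ Φ φ₂))) ∧
    ((MonotoneOnB0 K I ∧ NormalizedOnB0 K I ∧ ConstSuperadd K I) ↔
      (∃ Ψ : (S → ℝ) → Set ((S → ℝ) → ℝ),
        (∀ φ : S → ℝ, φ ∈ B0 K → ∀ H ∈ Ψ φ,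
          MonotoneOnB0 K H ∧ ConstAdditive K H ∧ ConcaveOnB0 K H) ∧
        (∀ φ : S → ℝ, φ ∈ B0 K → (∀ H ∈ Ψ φ, H φ ≤ I φ) ∧ ∃ H ∈ Ψ φ, H φ = I φ) ∧
        (∀ φ : S → ℝ, φ ∈ B0 K → ∀ k ∈ K,
          (∀ H ∈ Ψ φ, H (fun _ => k) ≤ k) ∧ ∃ H ∈ Ψ φ, H (fun _ => k) = k) ∧
        (∀ φ₁ : S → ℝ, φ₁ ∈ B0 K → ∀ φ₂ : S → ℝ, φ₂ ∈ B0 K →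
          (∀ s, φ₁ s ≤ φ₂ s) → Ψ φ₁ ⊆ Ψ φ₂))) := by
  refine ⟨⟨?_, ?_⟩, ⟨?_, ?_⟩⟩
  · rintro ⟨hmono, hnorm, hsup⟩
    have := nonempty_of_constSuperadd hsup
    refine ⟨fun φ => {J | ∃ ψ ∈ B0 K, (∀ s, φ s ≤ ψ s) ∧ J = fun χ => I ψ + supDiff χ ψ},
      ?_, ?_, ?_, ?_⟩
    · rintro φ - _ ⟨ψ, hψ, -, rfl⟩
      exact monotone_constAdditive_convex_supDiff hψ _
    · refine fun φ hφ => ⟨?_, _, ⟨φ, hφ, fun _ => le_rfl, rfl⟩, by simp [supDiff_self]⟩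
      rintro _ ⟨ψ, hψ, hle, rfl⟩
      exact le_add_supDiff_of_constSuperadd hK hmono hsup hφ hψ hle
    · refine fun φ hφ k hk => ⟨?_, ?_⟩
      · rintro _ ⟨ψ, hψ, -, rfl⟩
        obtain ⟨t, ht⟩ := exists_forall_ge_of_mem_B0 hψ
        have hψt := mem_of_mem_B0 hψ t
        have h₁ := hmono ψ hψ _ (const_mem_B0 hψt) ht
        rw [hnorm _ hψt] at h₁
        have h₂ := le_add_supDiff (const_mem_B0 hk) hψ t
        dsimp only at h₂ ⊢
        linarith
      · obtain ⟨t, ht⟩ := exists_forall_le_of_mem_B0 hφ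
        have hφt := mem_of_mem_B0 hφ t
        refine ⟨_, ⟨fun _ => φ t, const_mem_B0 hφt, ht, rfl⟩, ?_⟩
        simp [supDiff_const, hnorm _ hφt]
    · rintro φ₁ - φ₂ - hle _ ⟨ψ, hψ, h, rfl⟩
      exact ⟨ψ, hψ, fun s => (hle s).trans (h s), rfl⟩
  · rintro ⟨Φ, hΦ, hmin, hconst, hsub⟩
    refine ⟨fun φ hφ ψ hψ hle => ?_, fun k hk => ?_, fun φ hφ k hk hφk => ?_⟩
    · obtain ⟨J, hJ, hJφ⟩ := (hmin φ hφ).2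
      have h₁ := (hmin ψ hψ).1 J (hsub φ hφ ψ hψ hle hJ)
      have h₂ := (hΦ φ hφ J hJ).1 φ hφ ψ hψ hle
      linarith
    · have hmem : (fun _ : S => k) ∈ B0 K := const_mem_B0 hk
      obtain ⟨J, hJ, hJI⟩ := (hmin _ hmem).2
      obtain ⟨J', hJ', hJk⟩ := (hconst _ hmem k hk).2
      have h₁ := (hconst _ hmem k hk).1 J hJ
      have h₂ := (hmin _ hmem).1 J' hJ'
      linarith
    · obtain ⟨J, hJ, hJI⟩ := (hmin _ hφk).2
      have h₁ := (hmin φ hφ).1 J (hsub _ hφk φ hφ (fun s => by simpa using hk) hJ)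
      have h₂ := (hΦ _ hφk J hJ).2.1 φ hφ k hφk
      linarith
  · rintro ⟨hmono, hnorm, hsup⟩
    have := nonempty_of_constSuperadd hsup
    refine ⟨fun φ => {H | ∃ ψ ∈ B0 K, (∀ s, ψ s ≤ φ s) ∧ H = fun χ => I ψ - supDiff ψ χ},
      ?_, ?_, ?_, ?_⟩
    · rintro φ - _ ⟨ψ, hψ, -, rfl⟩
      exact monotone_constAdditive_concave_supDiff hψ _
    · refine fun φ hφ => ⟨?_, _, ⟨φ, hφ, fun _ => le_rfl, rfl⟩, by simp [supDiff_self]⟩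
      rintro _ ⟨ψ, hψ, hle, rfl⟩
      exact sub_le_iff_le_add.2 (le_add_supDiff_of_constSuperadd hK hmono hsup hψ hφ hle)
    · refine fun φ hφ k hk => ⟨?_, ?_⟩
      · rintro _ ⟨ψ, hψ, -, rfl⟩
        obtain ⟨t, ht⟩ := exists_forall_le_of_mem_B0 hψ
        have hψt := mem_of_mem_B0 hψ t
        have h₁ := hmono _ (const_mem_B0 hψt) ψ hψ ht
        rw [hnorm _ hψt] at h₁
        have h₂ := le_add_supDiff hψ (const_mem_B0 hk) t
        dsimp only at h₂ ⊢
        linarith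
      · obtain ⟨t, ht⟩ := exists_forall_ge_of_mem_B0 hφ
        have hφt := mem_of_mem_B0 hφ t
        refine ⟨_, ⟨fun _ => φ t, const_mem_B0 hφt, ht, rfl⟩, ?_⟩
        simp [supDiff_const, hnorm _ hφt]
    · rintro φ₁ - φ₂ - hle _ ⟨ψ, hψ, h, rfl⟩
      exact ⟨ψ, hψ, fun s => (h s).trans (hle s), rfl⟩
  · rintro ⟨Ψ, hΨ, hmax, hconst, hsub⟩
    refine ⟨fun φ hφ ψ hψ hle => ?_, fun k hk => ?_, fun φ hφ k hk hφk => ?_⟩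
    · obtain ⟨H, hH, hHψ⟩ := (hmax ψ hψ).2
      have h₁ := (hmax φ hφ).1 H (hsub ψ hψ φ hφ hle hH)
      have h₂ := (hΨ ψ hψ H hH).1 φ hφ ψ hψ hle
      linarith
    · have hmem : (fun _ : S => k) ∈ B0 K := const_mem_B0 hk
      obtain ⟨H, hH, hHI⟩ := (hmax _ hmem).2
      obtain ⟨H', hH', hHk⟩ := (hconst _ hmem k hk).2
      have h₁ := (hconst _ hmem k hk).1 H hH
      have h₂ := (hmax _ hmem).1 H' hH'
      linarith
    · obtain ⟨H, hH, hHI⟩ := (hmax φ hφ).2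
      have h₁ := (hmax _ hφk).1 H (hsub φ hφ _ hφk (fun s => by simpa using hk) hH)
      have h₂ := (hΨ φ hφ H hH).2.1 φ hφ k hφk
      linarith
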